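/- Let σ, d, β > 0, μ > 0, m_s > 1 and r > 0. Then ∫₀^∞ (r^μ/(σ²α²(βd)^{μ−1})) e^{−(r²+β²d²)/(2σ²α²)} I_{μ−1}(βdr/(σ²α²)) · (2(m_s−1)^{m_s} α^{−2m_s−1} e^{−(m_s−1)/α²}/Γ(m_s)) dα = (2^{m_s+1} (m_s−1)^{m_s} r^{2μ−1} σ^{2m_s} Γ(m_s+μ) / (Γ(m_s) Γ(μ) (r² + d²β² + 2(m_s−1)σ²)^{m_s+μ})) · ₂F₁((m_s+μ)/2, (1+m_s+μ)/2; μ; 4d²r²β² / (r² + d²β² + 2(m_s−1)σ²)²), where the argument of ₂F₁ lies in [0,1). -/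

import Mathlib

open MeasureTheory Set

/-- Pochhammer (rising factorial) symbol `(a)_n = Γ(a+n)/Γ(a)`. -/
noncomputable def poch (a : ℝ) (n : ℕ) : ℝ := Real.Gamma (a + n) / Real.Gamma a

/-- Beta function `B(x,y) = Γ(x)Γ(y)/Γ(x+y)`. -/
noncomputable def betaFn (x y : ℝ) : ℝ := Real.Gamma x * Real.Gamma y / Real.Gamma (x + y)

/-- Modified Bessel function of the first kind of real order ν. -/
noncomputable def besselI (ν x : ℝ) : ℝ :=
  ∑' k : ℕ, (x / 2) ^ (ν + 2 * (k : ℝ)) / ((k.factorial : ℝ) * Real.Gamma (ν + (k : ℝ) + 1))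

/-- Modified Bessel function of the second kind of real order ν. -/
noncomputable def besselK (ν x : ℝ) : ℝ :=
  ∫ t in Ioi (0 : ℝ), Real.exp (-x * Real.cosh t) * Real.cosh (ν * t)

/-- Confluent hypergeometric function ₁F₁(a;b;z). -/
noncomputable def hyp1F1 (a b z : ℝ) : ℝ :=
  ∑' n : ℕ, poch a n * z ^ n / (poch b n * (n.factorial : ℝ))

/-- Gauss hypergeometric function ₂F₁(a,b;c;z). -/
noncomputable def hyp2F1 (a b c z : ℝ) : ℝ :=
  ∑' n : ℕ, poch a n * poch b n * z ^ n / (poch c n * (n.factorial : ℝ))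

/-- Tricomi confluent hypergeometric function U(a,b,z). -/
noncomputable def tricomiU (a b z : ℝ) : ℝ :=
  (1 / Real.Gamma a) *
    ∫ t in Ioi (0 : ℝ), Real.exp (-z * t) * t ^ (a - 1) * (1 + t) ^ (b - a - 1)

/-- Regularized generalized hypergeometric function ₃F̃₁(a₁,a₂,a₃;b;z). -/
noncomputable def hyp3F1reg (a₁ a₂ a₃ b z : ℝ) : ℝ :=
  ∑' n : ℕ, poch a₁ n * poch a₂ n * poch a₃ n * z ^ n /
    (Real.Gamma (b + n) * (n.factorial : ℝ))

/-- Regularized generalized hypergeometric function ₂F̃₂(a,b;c,d;z). -/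
noncomputable def hyp2F2reg (a b c d z : ℝ) : ℝ :=
  ∑' n : ℕ, poch a n * poch b n * z ^ n /
    (Real.Gamma (c + n) * Real.Gamma (d + n) * (n.factorial : ℝ))

/-- The integrand obtained from the Gamma integrand by the substitution `y = x⁻²`. -/
theorem comp_rpow_neg_two_gamma_integrand (b s : ℝ) {x : ℝ} (hx : x ∈ Ioi (0 : ℝ)) :
    (|(-2 : ℝ)| * x ^ ((-2 : ℝ) - 1)) •
        ((x ^ (-2 : ℝ)) ^ (s - 1) * Real.exp (-(b * x ^ (-2 : ℝ)))) =
      2 * (x ^ (-2 * s - 1) * Real.exp (-(b * x ^ (-2 : ℝ)))) := by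
  have hx' : 0 < x := hx
  rw [← Real.rpow_mul hx'.le, smul_eq_mul, abs_neg, abs_two]
  have h : x ^ (-2 * s - 1) = x ^ ((-2 : ℝ) - 1) * x ^ (-2 * (s - 1)) := by
    rw [← Real.rpow_add hx']
    ring_nf
  rw [h]
  ring

theorem integrableOn_rpow_mul_exp_neg_mul_rpow_neg_two {b s : ℝ} (hb : 0 < b) (hs : 0 < s) :
    IntegrableOn (fun x : ℝ => x ^ (-2 * s - 1) * Real.exp (-(b * x ^ (-2 : ℝ))))
      (Ioi 0) := by
  have h1 : IntegrableOn (fun y : ℝ => y ^ (s - 1) * Real.exp (-(b * y))) (Ioi 0) := by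
    have := integrableOn_rpow_mul_exp_neg_mul_rpow (p := 1) (s := s - 1) (b := b)
      (by linarith) one_pos hb
    simpa using this
  have h2 := (integrableOn_Ioi_comp_rpow_iff _ (by norm_num : (-2 : ℝ) ≠ 0)).2 h1
  have h3 := (integrableOn_congr_fun
    (fun x hx => comp_rpow_neg_two_gamma_integrand b s hx) measurableSet_Ioi).1 h2
  exact (h3.const_mul (1 / 2)).congr (Filter.Eventually.of_forall fun x => by ring)

theorem integral_rpow_mul_exp_neg_mul_rpow_neg_two {b s : ℝ} (hb : 0 < b) (hs : 0 < s) :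
    ∫ x in Ioi (0 : ℝ), x ^ (-2 * s - 1) * Real.exp (-(b * x ^ (-2 : ℝ))) =
      (1 / b) ^ s * Real.Gamma s / 2 := by
  have h := integral_comp_rpow_Ioi (fun y : ℝ => y ^ (s - 1) * Real.exp (-(b * y)))
    (by norm_num : (-2 : ℝ) ≠ 0)
  rw [Real.integral_rpow_mul_exp_neg_mul_Ioi hs hb,
    setIntegral_congr_fun measurableSet_Ioi
      (fun x hx => comp_rpow_neg_two_gamma_integrand b s hx), integral_const_mul] at h
  linarith

theorem poch_pos {a : ℝ} (ha : 0 < a) (n : ℕ) : 0 < poch a n :=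
  div_pos (Real.Gamma_pos_of_pos (by positivity)) (Real.Gamma_pos_of_pos ha)

theorem poch_succ {a : ℝ} (ha : 0 < a) (n : ℕ) : poch a (n + 1) = poch a n * (a + n) := by
  have h : (a + n : ℝ) ≠ 0 := by positivity
  unfold poch
  rw [Nat.cast_succ, ← add_assoc, Real.Gamma_add_one h]
  ring

theorem gamma_add_two_mul {s : ℝ} (hs : 0 < s) (k : ℕ) :
    Real.Gamma (s + 2 * k) =
      Real.Gamma s * 4 ^ k * (poch (s / 2) k * poch ((1 + s) / 2) k) := by
  induction k with
  | zero =>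
    have h1 := (Real.Gamma_pos_of_pos (half_pos hs)).ne'
    have h2 := (Real.Gamma_pos_of_pos (show 0 < (1 + s) / 2 by positivity)).ne'
    simp [poch, h1, h2]
  | succ k ih =>
    have h1 : s + 2 * (k : ℝ) ≠ 0 := by positivity
    have h2 : s + 2 * (k : ℝ) + 1 ≠ 0 := by positivity
    rw [poch_succ (by positivity), poch_succ (by positivity),
      show s + 2 * ((k + 1 : ℕ) : ℝ) = s + 2 * (k : ℝ) + 1 + 1 by push_cast; ring,
      Real.Gamma_add_one h2, Real.Gamma_add_one h1, ih]
    ring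

theorem tendsto_add_natCast_div_add_natCast (a c : ℝ) :
    Filter.Tendsto (fun n : ℕ => (a + n) / (c + n)) Filter.atTop (nhds 1) := by
  simpa using tendsto_add_mul_div_add_mul_atTop_nhds a c (1 : ℝ) one_ne_zero

theorem summable_hyp2F1 {a b c z : ℝ} (ha : 0 < a) (hb : 0 < b) (hc : 0 < c)
    (hz : 0 < z) (hz1 : z < 1) :
    Summable fun n : ℕ => poch a n * poch b n * z ^ n / (poch c n * (n.factorial : ℝ)) := by
  have hpos : ∀ n : ℕ,
      0 < poch a n * poch b n * z ^ n / (poch c n * (n.factorial : ℝ)) := fun n => by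
    have := poch_pos ha n
    have := poch_pos hb n
    have := poch_pos hc n
    positivity
  refine summable_of_ratio_test_tendsto_lt_one hz1
    (Filter.Eventually.of_forall fun n => (hpos n).ne') ?_
  have h := ((tendsto_add_natCast_div_add_natCast a c).mul
    (tendsto_add_natCast_div_add_natCast b 1)).mul_const z
  rw [one_mul, one_mul] at h
  refine h.congr fun n => ?_
  rw [Real.norm_of_nonneg (hpos _).le, Real.norm_of_nonneg (hpos _).le,
    poch_succ ha, poch_succ hb, poch_succ hc, Nat.factorial_succ]
  have h1 := (poch_pos ha n).ne'
  have h2 := (poch_pos hb n).ne'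
  have h3 := (poch_pos hc n).ne'
  have h4 : c + (n : ℝ) ≠ 0 := by positivity
  have h5 : (1 : ℝ) + n ≠ 0 := by positivity
  have h6 : (n : ℝ) + 1 ≠ 0 := by positivity
  push_cast
  field_simp
  ring

/-- The `k`-th term of a Bessel series, mixed over an inverse Nakagami law. -/
theorem bessel_term_mul_rpow_mul_exp {c μ ms b α : ℝ} (hc : 0 < c) (hα : 0 < α) (k : ℕ) :
    (c / α ^ 2 / 2) ^ (μ - 1 + 2 * (k : ℝ)) * (α ^ (-2 * ms - 1) / α ^ 2) *
        Real.exp (-b / α ^ 2) =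
      (c / 2) ^ (μ - 1 + 2 * (k : ℝ)) *
        (α ^ (-2 * (ms + μ + 2 * k) - 1) * Real.exp (-(b * α ^ (-2 : ℝ)))) := by
  have h2 : α ^ (-2 : ℝ) = (α ^ 2)⁻¹ := by
    rw [Real.rpow_neg hα.le, Real.rpow_two]
  have h3 : c / α ^ 2 / 2 = c / 2 * α ^ (-2 : ℝ) := by
    rw [h2]
    ring
  have h4 : -b / α ^ 2 = -(b * α ^ (-2 : ℝ)) := by
    rw [h2]
    ring
  have h5 : α ^ (-2 * (ms + μ + 2 * k) - 1) =
      α ^ (-2 * (μ - 1 + 2 * (k : ℝ))) * (α ^ (-2 * ms - 1) * α ^ (-2 : ℝ)) := by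
    rw [← Real.rpow_add hα, ← Real.rpow_add hα]
    ring_nf
  rw [h3, h4, h5, Real.mul_rpow (by positivity) (by positivity), ← Real.rpow_mul hα.le, h2]
  ring

theorem kappa_mu_prefactor {σ β d μ ms r Q : ℝ} (hσ : 0 < σ) (hd : 0 < d) (hβ : 0 < β)
    (hr : 0 < r) (hQ : 0 < Q) (k : ℕ) :
    r ^ μ / (σ ^ 2 * (β * d) ^ (μ - 1)) * (β * d * r / σ ^ 2 / 2) ^ (μ - 1 + 2 * (k : ℝ)) *
        (1 / (Q / (2 * σ ^ 2))) ^ (ms + μ + 2 * (k : ℝ)) * 4 ^ k =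
      2 ^ (ms + 1) * r ^ (2 * μ - 1) * σ ^ (2 * ms) / Q ^ (ms + μ) *
        (4 * d ^ 2 * r ^ 2 * β ^ 2 / Q ^ 2) ^ k := by
  have hk : ∀ {x : ℝ}, 0 < x → ∀ e : ℝ, x ^ (e + 2 * (k : ℝ)) = x ^ e * (x ^ 2) ^ k := by
    intro x hx e
    rw [Real.rpow_add hx, ← pow_mul, ← Real.rpow_natCast x (2 * k)]
    push_cast
    rfl
  have hA : (β * d * r / σ ^ 2 / 2) ^ (μ - 1) =
      (β * d) ^ (μ - 1) * r ^ (μ - 1) / (2 * σ ^ 2) ^ (μ - 1) := by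
    rw [div_div, mul_comm (σ ^ 2), Real.div_rpow (by positivity) (by positivity),
      Real.mul_rpow (by positivity) hr.le]
  have hB : (1 / (Q / (2 * σ ^ 2))) ^ (ms + μ) = (2 * σ ^ 2) ^ (ms + μ) / Q ^ (ms + μ) := by
    rw [one_div_div, Real.div_rpow (by positivity) hQ.le]
  have hC : (2 * σ ^ 2) ^ (ms + μ) =
      2 ^ (ms + 1) * σ ^ (2 * ms) * σ ^ 2 * (2 * σ ^ 2) ^ (μ - 1) := by
    rw [show ms + μ = (ms + 1) + (μ - 1) by ring, Real.rpow_add (by positivity),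
      Real.mul_rpow (by positivity) (by positivity), ← Real.rpow_two σ,
      ← Real.rpow_mul hσ.le, mul_add, mul_one, Real.rpow_add hσ]
    ring
  have hD : r ^ (2 * μ - 1) = r ^ μ * r ^ (μ - 1) := by
    rw [← Real.rpow_add hr]
    ring_nf
  have hE : (4 * d ^ 2 * r ^ 2 * β ^ 2 / Q ^ 2) ^ k =
      ((β * d * r / σ ^ 2 / 2) ^ 2) ^ k * ((1 / (Q / (2 * σ ^ 2))) ^ 2) ^ k * 4 ^ k := by
    rw [← mul_pow, ← mul_pow]
    congr 1
    field_simp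
  have h1 : (β * d) ^ (μ - 1) ≠ 0 := (Real.rpow_pos_of_pos (by positivity) _).ne'
  have h2 : (2 * σ ^ 2) ^ (μ - 1) ≠ 0 := (Real.rpow_pos_of_pos (by positivity) _).ne'
  rw [hk (by positivity), hk (by positivity), hA, hB, hC, hD, hE]
  generalize ((β * d * r / σ ^ 2 / 2) ^ 2) ^ k = u
  generalize ((1 / (Q / (2 * σ ^ 2))) ^ 2) ^ k = v
  generalize (β * d) ^ (μ - 1) = w at h1 ⊢
  generalize (2 * σ ^ 2) ^ (μ - 1) = y at h2 ⊢
  field_simp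

/-- Appendix F conditional density identity (eq. (A.f4)): the κ-μ conditional
density with dominant amplitude βd and scattered scale σα, mixed over an
inverse Nakagami-m distributed α. -/
theorem appendixF_conditional_density
    (σ d β μ ms r : ℝ)
    (hσ : 0 < σ) (hd : 0 < d) (hβ : 0 < β) (hμ : 0 < μ) (hms : 1 < ms)
    (hr : 0 < r) :
    (0 ≤ 4 * d ^ 2 * r ^ 2 * β ^ 2 /
        (r ^ 2 + d ^ 2 * β ^ 2 + 2 * (ms - 1) * σ ^ 2) ^ 2 ∧
      4 * d ^ 2 * r ^ 2 * β ^ 2 /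
        (r ^ 2 + d ^ 2 * β ^ 2 + 2 * (ms - 1) * σ ^ 2) ^ 2 < 1) ∧
    (∫ α in Ioi (0 : ℝ),
      (r ^ μ / (σ ^ 2 * α ^ 2 * (β * d) ^ (μ - 1))) *
        Real.exp (-(r ^ 2 + β ^ 2 * d ^ 2) / (2 * σ ^ 2 * α ^ 2)) *
        besselI (μ - 1) (β * d * r / (σ ^ 2 * α ^ 2)) *
        (2 * (ms - 1) ^ ms * α ^ (-2 * ms - 1) *
          Real.exp (-(ms - 1) / α ^ 2) / Real.Gamma ms)) =
    (2 ^ (ms + 1) * (ms - 1) ^ ms * r ^ (2 * μ - 1) * σ ^ (2 * ms) *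
        Real.Gamma (ms + μ) /
        (Real.Gamma ms * Real.Gamma μ *
          (r ^ 2 + d ^ 2 * β ^ 2 + 2 * (ms - 1) * σ ^ 2) ^ (ms + μ))) *
      hyp2F1 ((ms + μ) / 2) ((1 + ms + μ) / 2) μ
        (4 * d ^ 2 * r ^ 2 * β ^ 2 /
          (r ^ 2 + d ^ 2 * β ^ 2 + 2 * (ms - 1) * σ ^ 2) ^ 2) := by
  set Q : ℝ := r ^ 2 + d ^ 2 * β ^ 2 + 2 * (ms - 1) * σ ^ 2 with hQdef
  have hms' : 0 < ms - 1 := by linarith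
  have hms0 : 0 < ms := by linarith
  have hσms : 0 < 2 * (ms - 1) * σ ^ 2 := by positivity
  have hQ : 0 < Q := by positivity
  have hlt : 2 * d * r * β < Q := by nlinarith [sq_nonneg (r - d * β)]
  set z : ℝ := 4 * d ^ 2 * r ^ 2 * β ^ 2 / Q ^ 2 with hzdef
  have hz : 0 < z := by positivity
  have hz1 : z < 1 := by
    rw [hzdef, div_lt_one (by positivity)]
    have h0 : 0 < 2 * d * r * β := by positivity
    nlinarith
  refine ⟨⟨hz.le, hz1⟩, ?_⟩
  set b : ℝ := Q / (2 * σ ^ 2) with hbdef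
  have hb : 0 < b := by positivity
  have hΓms := Real.Gamma_pos_of_pos hms0
  have hΓμ := Real.Gamma_pos_of_pos hμ
  let coef : ℕ → ℝ := fun k =>
    r ^ μ / (σ ^ 2 * (β * d) ^ (μ - 1)) * (2 * (ms - 1) ^ ms / Real.Gamma ms) *
      ((β * d * r / σ ^ 2 / 2) ^ (μ - 1 + 2 * (k : ℝ)) /
        ((k.factorial : ℝ) * Real.Gamma (μ - 1 + (k : ℝ) + 1)))
  let F : ℕ → ℝ → ℝ := fun k α =>
    coef k * (α ^ (-2 * (ms + μ + 2 * k) - 1) * Real.exp (-(b * α ^ (-2 : ℝ))))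
  let K : ℝ := 2 ^ (ms + 1) * (ms - 1) ^ ms * r ^ (2 * μ - 1) * σ ^ (2 * ms) *
    Real.Gamma (ms + μ) / (Real.Gamma ms * Real.Gamma μ * Q ^ (ms + μ))
  have hcoef : ∀ k, 0 ≤ coef k := fun k => by
    have : 0 < Real.Gamma (μ - 1 + (k : ℝ) + 1) := Real.Gamma_pos_of_pos (by
      rw [show μ - 1 + (k : ℝ) + 1 = μ + k by ring]
      positivity)
    positivity
  have hFint : ∀ k, Integrable (F k) (volume.restrict (Ioi 0)) := fun k =>
    (integrableOn_rpow_mul_exp_neg_mul_rpow_neg_two hb (by positivity)).const_mul _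
  have hFval : ∀ k : ℕ, ∫ α in Ioi (0 : ℝ), F k α =
      K * (poch ((ms + μ) / 2) k * poch ((1 + ms + μ) / 2) k * z ^ k /
        (poch μ k * (k.factorial : ℝ))) := fun k => by
    have hΓk : 0 < Real.Gamma (μ + k) := Real.Gamma_pos_of_pos (by positivity)
    have hpre := kappa_mu_prefactor (μ := μ) (ms := ms) hσ hd hβ hr hQ k
    rw [integral_const_mul,
      integral_rpow_mul_exp_neg_mul_rpow_neg_two hb (by positivity),
      gamma_add_two_mul (by positivity), ← add_assoc (1 : ℝ)]
    simp only [coef, K]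
    rw [show μ - 1 + (k : ℝ) + 1 = μ + k by ring]
    calc _ = (r ^ μ / (σ ^ 2 * (β * d) ^ (μ - 1)) *
            (β * d * r / σ ^ 2 / 2) ^ (μ - 1 + 2 * (k : ℝ)) *
            (1 / b) ^ (ms + μ + 2 * (k : ℝ)) * 4 ^ k) *
          ((ms - 1) ^ ms / Real.Gamma ms * Real.Gamma (ms + μ) *
            (poch ((ms + μ) / 2) k * poch ((1 + ms + μ) / 2) k) /
            ((k.factorial : ℝ) * Real.Gamma (μ + k))) := by ring
      _ = _ := by
        rw [hpre]
        simp only [poch.eq_1 μ]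
        rw [← hzdef]
        field_simp
  have hnorm : ∀ k : ℕ, ∫ α in Ioi (0 : ℝ), ‖F k α‖ = ∫ α in Ioi (0 : ℝ), F k α := fun k =>
    setIntegral_congr_fun measurableSet_Ioi fun α hα => Real.norm_of_nonneg
      (mul_nonneg (hcoef k) (mul_nonneg (Real.rpow_nonneg (le_of_lt hα) _) (Real.exp_nonneg _)))
  have hsum : Summable fun k : ℕ => ∫ α in Ioi (0 : ℝ), ‖F k α‖ := by
    simp only [hnorm, hFval]
    exact (summable_hyp2F1 (by positivity) (by positivity) hμ hz hz1).mul_left _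
  have hswap := (hasSum_integral_of_summable_integral_norm hFint hsum).tsum_eq
  simp only [hFval, tsum_mul_left] at hswap
  refine Eq.trans (setIntegral_congr_fun measurableSet_Ioi fun α hα => ?_) hswap.symm
  have hα' : 0 < α := hα
  simp only [besselI]
  rw [← tsum_mul_left, ← tsum_mul_right]
  refine tsum_congr fun k => ?_
  have hterm := bessel_term_mul_rpow_mul_exp (c := β * d * r / σ ^ 2) (μ := μ) (ms := ms)
    (b := b) (by positivity) hα' k
  have hexp : Real.exp (-b / α ^ 2) =
      Real.exp (-(r ^ 2 + β ^ 2 * d ^ 2) / (2 * σ ^ 2 * α ^ 2)) *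
        Real.exp (-(ms - 1) / α ^ 2) := by
    rw [← Real.exp_add]
    congr 1
    rw [hbdef, hQdef]
    field_simp
    ring
  rw [div_div (β * d * r) (σ ^ 2), hexp] at hterm
  simp only [F, coef]
  calc _ = r ^ μ / (σ ^ 2 * (β * d) ^ (μ - 1)) * (2 * (ms - 1) ^ ms / Real.Gamma ms) *
        (1 / ((k.factorial : ℝ) * Real.Gamma (μ - 1 + (k : ℝ) + 1))) *
        ((β * d * r / (σ ^ 2 * α ^ 2) / 2) ^ (μ - 1 + 2 * (k : ℝ)) *
          (α ^ (-2 * ms - 1) / α ^ 2) *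
          (Real.exp (-(r ^ 2 + β ^ 2 * d ^ 2) / (2 * σ ^ 2 * α ^ 2)) *
            Real.exp (-(ms - 1) / α ^ 2))) := by ring
    _ = _ := by
      rw [hterm]
      ring
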